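/- The critical dimension d** of the biharmonic Alt–Caffarelli problem equals 2. In particular, the function w : ℝ² → ℝ, w(x) = |x|²/4, is a nontrivial two-homogeneous global minimizer of F whose free boundary ∂{w = 0, ∇w = 0} = {0} is not a 1-dimensional C¹-submanifold of ℝ². -/

import Mathlib

open MeasureTheory Metric Set Filter Topology
open scoped ENNReal

noncomputable section

/-- `n`-dimensional Euclidean space. -/
abbrev RH (n : ℕ) := EuclideanSpace ℝ (Fin n)

variable {n : ℕ}

/-- Smooth compactly supported test functions with support contained in `Ω`. -/
def IsTestFun (Ω : Set (RH n)) (φ : RH n → ℝ) : Prop :=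
  ContDiff ℝ (⊤ : ℕ∞) φ ∧ HasCompactSupport φ ∧ tsupport φ ⊆ Ω

/-- Classical partial derivative in the `i`-th coordinate direction. -/
def cpderiv (i : Fin n) (φ : RH n → ℝ) : RH n → ℝ :=
  fun x => fderiv ℝ φ x (EuclideanSpace.single i 1)

/-- Classical Laplacian of a (smooth) function. -/
def cLaplacian (φ : RH n → ℝ) : RH n → ℝ :=
  fun x => ∑ i, cpderiv i (cpderiv i φ) x

/-- `g` is the weak `i`-th partial derivative of `u` on `Ω`. -/
def IsWeakPartial (Ω : Set (RH n)) (i : Fin n) (u g : RH n → ℝ) : Prop :=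
  ∀ φ : RH n → ℝ, IsTestFun Ω φ →
    ∫ x in Ω, u x * cpderiv i φ x = - ∫ x in Ω, g x * φ x

/-- `g` is a weak Laplacian of `u` on `Ω`. -/
def IsWeakLaplacian (Ω : Set (RH n)) (u g : RH n → ℝ) : Prop :=
  ∀ φ : RH n → ℝ, IsTestFun Ω φ →
    ∫ x in Ω, u x * cLaplacian φ x = ∫ x in Ω, g x * φ x

/-- `u ∈ H²(Ω)` with weak gradient `g` and weak Hessian `h`. -/
def IsH2With (Ω : Set (RH n)) (u : RH n → ℝ) (g : Fin n → RH n → ℝ)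
    (h : Fin n → Fin n → RH n → ℝ) : Prop :=
  MemLp u 2 (volume.restrict Ω) ∧
  (∀ i, IsWeakPartial Ω i u (g i) ∧ MemLp (g i) 2 (volume.restrict Ω)) ∧
  (∀ i j, IsWeakPartial Ω j (g i) (h i j) ∧ MemLp (h i j) 2 (volume.restrict Ω))

/-- `u ∈ H²(Ω)`. -/
def MemH2 (Ω : Set (RH n)) (u : RH n → ℝ) : Prop :=
  ∃ g h, IsH2With Ω u g h

/-- `u ∈ H₀²(Ω)`: `u ∈ H²(Ω)` and `u` is approximable in the `H²`-norm by
test functions supported in `Ω`. -/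
def MemH20 (Ω : Set (RH n)) (u : RH n → ℝ) : Prop :=
  ∃ g h, IsH2With Ω u g h ∧
    ∃ φ : ℕ → RH n → ℝ, (∀ k, IsTestFun Ω (φ k)) ∧
      Tendsto (fun k => eLpNorm (fun x => u x - φ k x) 2 (volume.restrict Ω)) atTop (𝓝 0) ∧
      (∀ i, Tendsto (fun k => eLpNorm (fun x => g i x - cpderiv i (φ k) x) 2
        (volume.restrict Ω)) atTop (𝓝 0)) ∧
      (∀ i j, Tendsto (fun k => eLpNorm (fun x => h i j x - cpderiv j (cpderiv i (φ k)) x) 2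
        (volume.restrict Ω)) atTop (𝓝 0))

/-- `u ∈ H²_loc(ℝⁿ)`. -/
def MemH2loc (u : RH n → ℝ) : Prop :=
  ∀ Ω : Set (RH n), IsOpen Ω → Bornology.IsBounded Ω → MemH2 Ω u

/-- The two-sided biharmonic Alt–Caffarelli functional
`F(u,Ω) = ∫_Ω (Δu)² dx + |{x ∈ Ω : u x ≠ 0}|`, where the (weak) Laplacian
`Δu = lapu` is given explicitly. -/
def ACF (Ω : Set (RH n)) (lapu u : RH n → ℝ) : ℝ :=
  (∫ x in Ω, (lapu x) ^ 2) + (volume {x ∈ Ω | u x ≠ 0}).toReal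

/-- `u` is a global minimizer of the two-sided biharmonic Alt–Caffarelli functional. -/
def IsGlobalMinimizer (u : RH n → ℝ) : Prop :=
  MemH2loc u ∧
  ∀ Ω : Set (RH n), IsOpen Ω → Bornology.IsBounded Ω →
    ∀ v : RH n → ℝ, MemH2 Ω v → MemH20 Ω (fun x => v x - u x) →
      ∀ lapu lapv : RH n → ℝ, IsWeakLaplacian Ω u lapu → IsWeakLaplacian Ω v lapv →
        ACF Ω lapu u ≤ ACF Ω lapv v


/-- `z` is (positively) two-homogeneous. -/
def TwoHomogeneous {n : ℕ} (z : RH n → ℝ) : Prop :=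
  ∀ lam : ℝ, 0 < lam → ∀ x, z (lam • x) = lam ^ 2 * z x

/-- The free boundary `∂{z = 0, ∇z = 0}`. -/
def FreeBoundary {n : ℕ} (z : RH n → ℝ) : Set (RH n) :=
  frontier {x | z x = 0 ∧ fderiv ℝ z x = 0}

/-- `s` is a `k`-dimensional `C¹`-submanifold of `ℝⁿ`: locally, `s` is the regular
zero level set of a `C¹` map into `ℝ^{n-k}`. -/
def IsC1Submanifold (n k : ℕ) (s : Set (RH n)) : Prop :=
  ∀ x ∈ s, ∃ U : Set (RH n), IsOpen U ∧ x ∈ U ∧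
    ∃ f : RH n → EuclideanSpace ℝ (Fin (n - k)),
      ContDiffOn ℝ 1 f U ∧ s ∩ U = {y ∈ U | f y = 0} ∧
      ∀ y ∈ s ∩ U, Function.Surjective (fderivWithin ℝ f U y)

/-- Dimension `d` admits a nontrivial two-homogeneous global minimizer of `F` whose
free boundary is not a `(d-1)`-dimensional `C¹`-submanifold of `ℝᵈ`. -/
def HasSingularTwoHomogeneousMinimizer (d : ℕ) : Prop :=
  ∃ z : RH d → ℝ, z ≠ (fun _ => 0) ∧ TwoHomogeneous z ∧ IsGlobalMinimizer z ∧
    ¬ IsC1Submanifold d (d - 1) (FreeBoundary z)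

/-! ### Integrals and almost everywhere statements -/

lemma tendsto_integral_mul_of_tendsto_eLpNorm {α : Type*} [MeasurableSpace α] {μ : Measure α}
    [IsFiniteMeasure μ] {F m : ℕ → α → ℝ} (hF : ∀ k, AEStronglyMeasurable (F k) μ) {M : ℝ}
    (hm : ∀ k x, |m k x| ≤ M) (h : Tendsto (fun k => eLpNorm (F k) 2 μ) atTop (𝓝 0)) :
    Tendsto (fun k => ∫ x, m k x * F k x ∂μ) atTop (𝓝 0) := by
  rw [tendsto_zero_iff_enorm_tendsto_zero]
  set C : ℝ≥0∞ := μ univ ^ (1 / (1 : ℝ≥0∞).toReal - 1 / (2 : ℝ≥0∞).toReal)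
  have hC : C ≠ ∞ := ENNReal.rpow_ne_top_of_nonneg (by norm_num) (measure_ne_top μ univ)
  have hlim : Tendsto (fun k => ENNReal.ofReal M * (eLpNorm (F k) 2 μ * C)) atTop (𝓝 0) := by
    have h1 := ENNReal.Tendsto.mul_const h (Or.inr hC)
    have h2 := ENNReal.Tendsto.const_mul (a := ENNReal.ofReal M) h1 (Or.inr ENNReal.ofReal_ne_top)
    simpa using h2
  refine tendsto_of_tendsto_of_tendsto_of_le_of_le tendsto_const_nhds hlim
    (fun _ => zero_le) fun k => ?_
  calc ‖∫ x, m k x * F k x ∂μ‖ₑ ≤ ∫⁻ x, ‖m k x * F k x‖ₑ ∂μ := enorm_integral_le_lintegral_enorm _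
    _ = eLpNorm (fun x => m k x * F k x) 1 μ := eLpNorm_one_eq_lintegral_enorm.symm
    _ ≤ ENNReal.ofReal M * eLpNorm (F k) 1 μ := by
        refine eLpNorm_le_mul_eLpNorm_of_ae_le_mul (Eventually.of_forall fun x => ?_) 1
        rw [norm_mul]
        exact mul_le_mul_of_nonneg_right (hm k x) (norm_nonneg _)
    _ ≤ ENNReal.ofReal M * (eLpNorm (F k) 2 μ * C) := by
        gcongr
        exact eLpNorm_le_eLpNorm_mul_rpow_measure_univ (by norm_num) (hF k)

lemma IsTestFun.continuous {Ω : Set (RH n)} {η : RH n → ℝ} (hη : IsTestFun Ω η) :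
    Continuous η := hη.1.continuous

lemma IsTestFun.eq_zero {Ω : Set (RH n)} {η : RH n → ℝ} (hη : IsTestFun Ω η) {x : RH n}
    (hx : x ∉ Ω) : η x = 0 :=
  image_eq_zero_of_notMem_tsupport fun h => hx (hη.2.2 h)

lemma ContDiff.cpderiv {f : RH n → ℝ} (hf : ContDiff ℝ (⊤ : ℕ∞) f) (i : Fin n) :
    ContDiff ℝ (⊤ : ℕ∞) (cpderiv i f) :=
  (hf.fderiv_right (m := (⊤ : ℕ∞)) (by simp)).clm_apply contDiff_const

lemma IsTestFun.cpderiv {Ω : Set (RH n)} {η : RH n → ℝ} (hη : IsTestFun Ω η) (i : Fin n) :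
    IsTestFun Ω (cpderiv i η) := by
  refine ⟨hη.1.cpderiv i, hη.2.1.fderiv_apply ℝ _, ?_⟩
  exact (tsupport_fderiv_apply_subset ℝ _).trans hη.2.2

lemma IsTestFun.add {Ω : Set (RH n)} {η ψ : RH n → ℝ} (hη : IsTestFun Ω η)
    (hψ : IsTestFun Ω ψ) : IsTestFun Ω (fun x => η x + ψ x) :=
  ⟨hη.1.add hψ.1, hη.2.1.add hψ.2.1,
    (tsupport_add η ψ).trans (union_subset hη.2.2 hψ.2.2)⟩

lemma IsTestFun.exists_abs_le {Ω : Set (RH n)} {η : RH n → ℝ} (hη : IsTestFun Ω η) :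
    ∃ C, ∀ x, |η x| ≤ C :=
  hη.2.1.exists_bound_of_continuous hη.continuous

/-- Integration by parts against a test function. -/
lemma setIntegral_mul_cpderiv {Ω : Set (RH n)} {f η : RH n → ℝ} (hf : ContDiff ℝ 1 f)
    (hη : IsTestFun Ω η) (i : Fin n) :
    ∫ x in Ω, f x * cpderiv i η x = - ∫ x in Ω, cpderiv i f x * η x := by
  have hη' := hη.cpderiv i
  have hf' : Continuous (cpderiv i f) := (hf.continuous_fderiv (by simp)).clm_apply continuous_const
  rw [setIntegral_eq_integral_of_forall_compl_eq_zero (fun x hx => by simp [hη'.eq_zero hx]),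
    setIntegral_eq_integral_of_forall_compl_eq_zero (fun x hx => by simp [hη.eq_zero hx])]
  refine integral_mul_fderiv_eq_neg_fderiv_mul_of_integrable ?_ ?_ ?_ ?_ ?_
  · exact (hf'.mul hη.continuous).integrable_of_hasCompactSupport hη.2.1.mul_left
  · exact (hf.continuous.mul hη'.continuous).integrable_of_hasCompactSupport hη'.2.1.mul_left
  · exact (hf.continuous.mul hη.continuous).integrable_of_hasCompactSupport hη.2.1.mul_left
  · exact fun x _ => hf.differentiable (by simp) x
  · exact fun x _ => hη.1.differentiable (by simp) x

lemma ae_eq_zero_of_forall_testFun {Ω : Set (RH n)} (hΩ : IsOpen Ω) {f : RH n → ℝ}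
    (hf : LocallyIntegrableOn f Ω volume)
    (h : ∀ η, IsTestFun Ω η → ∫ x in Ω, f x * η x = 0) :
    ∀ᵐ x ∂(volume.restrict Ω), f x = 0 := by
  rw [ae_restrict_iff' hΩ.measurableSet]
  refine hΩ.ae_eq_zero_of_integral_contDiff_smul_eq_zero hf fun η h1 h2 h3 => ?_
  have hη : IsTestFun Ω η := ⟨h1, h2, h3⟩
  rw [← h η hη, setIntegral_eq_integral_of_forall_compl_eq_zero
    (fun x hx => by simp [hη.eq_zero hx])]
  simp [mul_comm]

/-- A function `G` with the same moments as an integrable `L` agrees with `L` almost everywhere,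
unless `L` vanishes (in which case `G` may fail to be locally integrable). -/
lemma ae_eq_or_ae_eq_zero_of_forall_testFun {Ω : Set (RH n)} (hΩ : IsOpen Ω) {G L : RH n → ℝ}
    (hL : IntegrableOn L Ω volume)
    (h : ∀ η, IsTestFun Ω η → ∫ x in Ω, G x * η x = ∫ x in Ω, L x * η x) :
    (∀ᵐ x ∂(volume.restrict Ω), G x = L x) ∨ ∀ᵐ x ∂(volume.restrict Ω), L x = 0 := by
  have hLη : ∀ η, IsTestFun Ω η → IntegrableOn (fun x => L x * η x) Ω volume := by
    intro η hη
    obtain ⟨C, hC⟩ := hη.exists_abs_le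
    exact Integrable.mul_bdd hL hη.continuous.aestronglyMeasurable (Eventually.of_forall hC)
  by_cases hG : LocallyIntegrableOn G Ω volume
  · left
    have hGη : ∀ η, IsTestFun Ω η → IntegrableOn (fun x => G x * η x) Ω volume := by
      intro η hη
      have h1 : IntegrableOn G (tsupport η) volume :=
        hG.integrableOn_compact_subset hη.2.2 hη.2.1
      obtain ⟨C, hC⟩ := hη.exists_abs_le
      have h2 : IntegrableOn (fun x => G x * η x) (tsupport η) volume :=
        Integrable.mul_bdd h1 hη.continuous.aestronglyMeasurable (Eventually.of_forall hC)
      refine (h2.integrable_of_forall_notMem_eq_zero fun x hx => ?_).integrableOn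
      simp [image_eq_zero_of_notMem_tsupport hx]
    have := ae_eq_zero_of_forall_testFun hΩ (hG.sub hL.locallyIntegrableOn) fun η hη => by
      simp only [Pi.sub_apply, sub_mul]
      rw [integral_sub (hGη η hη) (hLη η hη), h η hη, sub_self]
    filter_upwards [this] with x hx
    exact sub_eq_zero.1 hx
  · right
    simp only [LocallyIntegrableOn, not_forall] at hG
    obtain ⟨x₀, hx₀, hG⟩ := hG
    have key : ∀ η, IsTestFun Ω η → η x₀ ≠ 0 → ∫ x in Ω, L x * η x = 0 := by
      intro η hη h0
      rw [← h η hη]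
      refine integral_undef fun h_int => hG ?_
      have hV : {x | |η x₀| / 2 < |η x|} ∈ 𝓝 x₀ :=
        (isOpen_lt continuous_const hη.continuous.abs).mem_nhds
          (half_lt_self (abs_pos.2 h0))
      refine ⟨{x | |η x₀| / 2 < |η x|} ∩ Ω, ?_, ?_⟩
      · exact inter_mem (mem_nhdsWithin_of_mem_nhds hV) self_mem_nhdsWithin
      · have hmeas : MeasurableSet ({x | |η x₀| / 2 < |η x|} ∩ Ω) :=
          (isOpen_lt continuous_const hη.continuous.abs).measurableSet.inter hΩ.measurableSet
        have h1 : IntegrableOn (fun x => G x * η x) ({x | |η x₀| / 2 < |η x|} ∩ Ω) volume :=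
          IntegrableOn.mono_set h_int inter_subset_right
        have h2 : IntegrableOn (fun x => G x * η x * (η x)⁻¹)
            ({x | |η x₀| / 2 < |η x|} ∩ Ω) volume := by
          refine Integrable.mul_bdd (c := (|η x₀| / 2)⁻¹) h1
            hη.continuous.measurable.inv.aestronglyMeasurable ?_
          filter_upwards [ae_restrict_mem hmeas] with x hx
          rw [norm_inv, Real.norm_eq_abs]
          exact inv_anti₀ (half_pos (abs_pos.2 h0)) hx.1.le
        refine h2.congr_fun (fun x hx => ?_) hmeas
        have : η x ≠ 0 := abs_pos.1 ((half_pos (abs_pos.2 h0)).trans hx.1)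
        field_simp
    obtain ⟨ψ, hψ1, hψ2, hψ3, -, hψ4⟩ :=
      exists_contDiff_tsupport_subset (n := ⊤) (hΩ.mem_nhds hx₀)
    have hψ : IsTestFun Ω ψ := ⟨hψ3, hψ2, hψ1⟩
    refine ae_eq_zero_of_forall_testFun hΩ hL.locallyIntegrableOn fun η hη => ?_
    by_cases h0 : η x₀ = 0
    · have h1 := key _ (hη.add hψ) (by simp [h0, hψ4])
      have h2 := key _ hψ (by simp [hψ4])
      simp only [mul_add] at h1
      rwa [integral_add (hLη η hη) (hLη ψ hψ), h2, add_zero] at h1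
    · exact key η hη h0

/-! ### Vanishing of derivatives on level sets -/

lemma cpderiv_arctan {f : RH n → ℝ} (hf : ContDiff ℝ (⊤ : ℕ∞) f) (i : Fin n) {c : ℝ}
    (hc : c ≠ 0) (x : RH n) :
    cpderiv i (fun y => Real.arctan (c * f y) / c) x
      = (1 + (c * f x) ^ 2)⁻¹ * cpderiv i f x := by
  have h1 : HasFDerivAt f (fderiv ℝ f x) x := (hf.differentiable (by simp) x).hasFDerivAt
  have h2 := ((h1.const_mul c).arctan).mul_const c⁻¹
  simp only [cpderiv, div_eq_mul_inv]
  rw [h2.fderiv]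
  simp
  field_simp

lemma tendsto_inv_one_add_sq_mul (a b : ℝ) :
    Tendsto (fun m : ℕ => (1 + (((m : ℝ) + 1) * a) ^ 2)⁻¹ * b) atTop
      (𝓝 (if a = 0 then b else 0)) := by
  split_ifs with ha
  · simp [ha]
  · have h1 : Tendsto (fun m : ℕ => (m : ℝ) + 1) atTop atTop :=
      tendsto_atTop_add_const_right _ _ tendsto_natCast_atTop_atTop
    have h2 : Tendsto (fun m : ℕ => 1 + (((m : ℝ) + 1) * a) ^ 2) atTop atTop := by
      refine tendsto_atTop_add_const_left _ _ ?_
      simp only [mul_pow]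
      exact ((tendsto_pow_atTop two_ne_zero).comp h1).atTop_mul_const (by positivity)
    simpa using h2.inv_tendsto_atTop.mul_const b

lemma abs_inv_one_add_sq_le_one (a : ℝ) : |(1 + a ^ 2)⁻¹| ≤ 1 := by
  rw [abs_of_nonneg (by positivity)]
  exact inv_le_one_of_one_le₀ (by nlinarith [sq_nonneg a])

lemma abs_arctan_le (a : ℝ) : |Real.arctan a| ≤ Real.pi / 2 :=
  abs_le.2 ⟨(Real.neg_pi_div_two_lt_arctan a).le, (Real.arctan_lt_pi_div_two a).le⟩

/-- The chain rule for `arctan (c * w) / c`, in weak form, for a Sobolev limit `w` of smooth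
functions. -/
lemma setIntegral_arctan_mul_cpderiv {Ω : Set (RH n)} [IsFiniteMeasure (volume.restrict Ω)]
    {w g : RH n → ℝ} {wk : ℕ → RH n → ℝ} {i : Fin n}
    (hw : MemLp w 2 (volume.restrict Ω)) (hg : MemLp g 2 (volume.restrict Ω))
    (hwk : ∀ k, ContDiff ℝ (⊤ : ℕ∞) (wk k))
    (h1 : Tendsto (fun k => eLpNorm (fun x => w x - wk k x) 2 (volume.restrict Ω)) atTop (𝓝 0))
    (h2 : Tendsto (fun k => eLpNorm (fun x => g x - cpderiv i (wk k) x) 2 (volume.restrict Ω))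
      atTop (𝓝 0)) {η : RH n → ℝ} (hη : IsTestFun Ω η) {c : ℝ} (hc : 0 < c) :
    ∫ x in Ω, Real.arctan (c * w x) / c * cpderiv i η x
      = - ∫ x in Ω, (1 + (c * w x) ^ 2)⁻¹ * g x * η x := by
  have hmeas : TendstoInMeasure (volume.restrict Ω) wk atTop w := by
    refine tendstoInMeasure_of_tendsto_eLpNorm two_ne_zero
      (fun k => (hwk k).continuous.aestronglyMeasurable) hw.1 ?_
    refine h1.congr fun k => ?_
    rw [← eLpNorm_neg]
    congr 1
    ext x
    simp
  obtain ⟨ns, hns, hae⟩ := hmeas.exists_seq_tendsto_ae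
  obtain ⟨C, hC⟩ := hη.exists_abs_le
  obtain ⟨C', hC'⟩ := (hη.cpderiv i).exists_abs_le
  have hgi : Integrable g (volume.restrict Ω) := hg.integrable (by norm_num)
  have hcpη : Continuous (cpderiv i η) := (hη.cpderiv i).continuous
  have hcη := hη.continuous
  have hcw : ∀ k, Continuous (wk k) := fun k => (hwk k).continuous
  have hcinv : ∀ k, Continuous (fun x => (1 + (c * wk k x) ^ 2)⁻¹) := fun k =>
    Continuous.inv₀ (by have := hcw k; fun_prop) (fun x => by positivity)
  have hcD : ∀ k, Continuous (cpderiv i (wk k)) := fun k => ((hwk k).cpderiv i).continuous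
  have hL : Tendsto (fun k => ∫ x in Ω, Real.arctan (c * wk (ns k) x) / c * cpderiv i η x) atTop
      (𝓝 (∫ x in Ω, Real.arctan (c * w x) / c * cpderiv i η x)) := by
    refine tendsto_integral_of_dominated_convergence (fun _ => Real.pi / 2 / c * C')
      (fun k => ?_) (integrable_const _) (fun k => Eventually.of_forall fun x => ?_) ?_
    · have := hcw (ns k)
      exact Continuous.aestronglyMeasurable (by fun_prop)
    · rw [norm_mul, Real.norm_eq_abs, Real.norm_eq_abs, abs_div, abs_of_pos hc]
      have := abs_arctan_le (c * wk (ns k) x)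
      gcongr
      exact hC' x
    · filter_upwards [hae] with x hx
      have : Continuous fun t => Real.arctan (c * t) / c * cpderiv i η x := by fun_prop
      exact (this.tendsto _).comp hx
  have hR1 : Tendsto (fun k => ∫ x in Ω, (1 + (c * wk (ns k) x) ^ 2)⁻¹ * g x * η x) atTop
      (𝓝 (∫ x in Ω, (1 + (c * w x) ^ 2)⁻¹ * g x * η x)) := by
    refine tendsto_integral_of_dominated_convergence (fun x => |g x| * C)
      (fun k => ?_) (hgi.abs.mul_const _) (fun k => Eventually.of_forall fun x => ?_) ?_
    · exact ((hcinv _).aestronglyMeasurable.mul hg.1).mul hcη.aestronglyMeasurable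
    · rw [norm_mul, norm_mul, Real.norm_eq_abs, Real.norm_eq_abs, Real.norm_eq_abs]
      have := abs_inv_one_add_sq_le_one (c * wk (ns k) x)
      gcongr
      · exact mul_le_of_le_one_left (abs_nonneg _) this
      · exact hC x
    · filter_upwards [hae] with x hx
      have : Continuous fun t => (1 + (c * t) ^ 2)⁻¹ * g x * η x := by
        have : Continuous fun t : ℝ => (1 + (c * t) ^ 2)⁻¹ :=
          Continuous.inv₀ (by fun_prop) (fun x => by positivity)
        fun_prop
      exact (this.tendsto _).comp hx
  have hR2 : Tendsto (fun k => ∫ x in Ω, ((1 + (c * wk (ns k) x) ^ 2)⁻¹ * η x) *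
      (g x - cpderiv i (wk (ns k)) x)) atTop (𝓝 0) := by
    refine tendsto_integral_mul_of_tendsto_eLpNorm (M := C) (fun k => ?_) (fun k x => ?_)
      (h2.comp hns.tendsto_atTop)
    · exact hg.1.sub (hcD _).aestronglyMeasurable
    · rw [abs_mul]
      exact (mul_le_of_le_one_left (abs_nonneg _) (abs_inv_one_add_sq_le_one _)).trans (hC x)
  refine tendsto_nhds_unique hL ?_
  have hR := (hR1.sub hR2).neg
  rw [sub_zero] at hR
  refine hR.congr fun k => ?_
  have hk : ContDiff ℝ 1 (fun y => Real.arctan (c * wk (ns k) y) / c) :=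
    ((contDiff_const.mul ((hwk (ns k)).of_le (by simp))).arctan).div_const _
  rw [setIntegral_mul_cpderiv hk hη i, ← integral_sub]
  · congr 2
    ext x
    rw [cpderiv_arctan (hwk _) i hc.ne']
    ring
  · refine Integrable.mul_bdd (c := C) (Integrable.bdd_mul (c := 1) hgi
      (hcinv _).aestronglyMeasurable (Eventually.of_forall fun x => ?_))
      hcη.aestronglyMeasurable (Eventually.of_forall hC)
    exact abs_inv_one_add_sq_le_one _
  · have hd : (fun x => ((1 + (c * wk (ns k) x) ^ 2)⁻¹ * η x) * (g x - cpderiv i (wk (ns k)) x))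
        = fun x => ((1 + (c * wk (ns k) x) ^ 2)⁻¹ * η x) * g x -
          ((1 + (c * wk (ns k) x) ^ 2)⁻¹ * cpderiv i (wk (ns k)) x) * η x := by
      ext x
      ring
    rw [hd]
    refine Integrable.sub ?_ ?_
    · refine Integrable.bdd_mul (c := C) hgi
        ((hcinv _).mul hcη).aestronglyMeasurable (Eventually.of_forall fun x => ?_)
      rw [norm_mul]
      exact (mul_le_of_le_one_left (abs_nonneg _) (abs_inv_one_add_sq_le_one _)).trans (hC x)
    · exact (Continuous.integrable_of_hasCompactSupport
        (((hcinv _).mul (hcD _)).mul hcη) hη.2.1.mul_left).integrableOn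

/-- The weak derivative of a Sobolev function vanishes almost everywhere on its zero set. -/
lemma ae_eq_zero_imp_deriv_eq_zero {Ω : Set (RH n)} (hΩ : IsOpen Ω)
    [IsFiniteMeasure (volume.restrict Ω)]
    {w g : RH n → ℝ} {wk : ℕ → RH n → ℝ} {i : Fin n}
    (hw : MemLp w 2 (volume.restrict Ω)) (hg : MemLp g 2 (volume.restrict Ω))
    (hwk : ∀ k, ContDiff ℝ (⊤ : ℕ∞) (wk k))
    (h1 : Tendsto (fun k => eLpNorm (fun x => w x - wk k x) 2 (volume.restrict Ω)) atTop (𝓝 0))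
    (h2 : Tendsto (fun k => eLpNorm (fun x => g x - cpderiv i (wk k) x) 2 (volume.restrict Ω))
      atTop (𝓝 0)) :
    ∀ᵐ x ∂(volume.restrict Ω), w x = 0 → g x = 0 := by
  have hgi : Integrable g (volume.restrict Ω) := hg.integrable (by norm_num)
  have hmm : ∀ m : ℕ, AEStronglyMeasurable
      (fun x => (1 + (((m : ℝ) + 1) * w x) ^ 2)⁻¹ * g x) (volume.restrict Ω) := fun m =>
    (((hw.1.aemeasurable.const_mul _).pow_const 2).const_add 1).inv.aestronglyMeasurable.mul hg.1
  have hbd : ∀ (m : ℕ) (x : RH n), |(1 + (((m : ℝ) + 1) * w x) ^ 2)⁻¹ * g x| ≤ |g x| := by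
    intro m x
    rw [abs_mul]
    exact mul_le_of_le_one_left (abs_nonneg _) (abs_inv_one_add_sq_le_one _)
  have hF : Integrable (fun x => if w x = 0 then g x else 0) (volume.restrict Ω) := by
    refine hgi.mono (aestronglyMeasurable_of_tendsto_ae atTop hmm
      (Eventually.of_forall fun x => tendsto_inv_one_add_sq_mul (w x) (g x)))
      (Eventually.of_forall fun x => ?_)
    split_ifs <;> simp
  have hz : ∀ᵐ x ∂(volume.restrict Ω), (if w x = 0 then g x else 0) = 0 := by
    refine ae_eq_zero_of_forall_testFun hΩ
      (IntegrableOn.locallyIntegrableOn hF) fun η hη => ?_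
    obtain ⟨C, hC⟩ := hη.exists_abs_le
    obtain ⟨C', hC'⟩ := (hη.cpderiv i).exists_abs_le
    have hR : Tendsto (fun m : ℕ => ∫ x in Ω, (1 + (((m : ℝ) + 1) * w x) ^ 2)⁻¹ * g x * η x) atTop
        (𝓝 (∫ x in Ω, (if w x = 0 then g x else 0) * η x)) := by
      refine tendsto_integral_of_dominated_convergence (fun x => |g x| * C)
        (fun m => (hmm m).mul hη.continuous.aestronglyMeasurable) (hgi.abs.mul_const _)
        (fun m => Eventually.of_forall fun x => ?_)
        (Eventually.of_forall fun x => (tendsto_inv_one_add_sq_mul (w x) (g x)).mul_const _)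
      rw [norm_mul]
      exact mul_le_mul (hbd m x) (hC x) (norm_nonneg _) (abs_nonneg _)
    have hc : ∀ m : ℕ, (0 : ℝ) < (m : ℝ) + 1 := fun m => by positivity
    have hL : Tendsto (fun m : ℕ => ∫ x in Ω,
        Real.arctan (((m : ℝ) + 1) * w x) / ((m : ℝ) + 1) * cpderiv i η x) atTop
        (𝓝 (∫ x in Ω, (0 : ℝ))) := by
      refine tendsto_integral_of_dominated_convergence (fun _ => Real.pi / 2 * C')
        (fun m => ?_) (integrable_const _) (fun m => Eventually.of_forall fun x => ?_)
        (Eventually.of_forall fun x => ?_)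
      · exact ((Real.measurable_arctan.comp_aemeasurable
          (hw.1.aemeasurable.const_mul _)).div_const _).aestronglyMeasurable.mul
          (hη.cpderiv i).continuous.aestronglyMeasurable
      · rw [norm_mul, Real.norm_eq_abs, Real.norm_eq_abs, abs_div, abs_of_pos (hc m)]
        refine mul_le_mul ((div_le_self (abs_nonneg _) ?_).trans (abs_arctan_le _)) (hC' x)
          (abs_nonneg _) (by positivity)
        linarith [(Nat.cast_nonneg m : (0 : ℝ) ≤ m)]
      · have h1 : Tendsto (fun m : ℕ => (m : ℝ) + 1) atTop atTop :=
          tendsto_atTop_add_const_right _ _ tendsto_natCast_atTop_atTop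
        have h3 : Tendsto (fun m : ℕ =>
            Real.arctan (((m : ℝ) + 1) * w x) / ((m : ℝ) + 1)) atTop (𝓝 0) := by
          refine squeeze_zero_norm (fun m => ?_) (h1.const_div_atTop (Real.pi / 2))
          rw [Real.norm_eq_abs, abs_div, abs_of_pos (hc m)]
          gcongr
          exact abs_arctan_le _
        simpa using h3.mul_const (cpderiv i η x)
    have heq := tendsto_nhds_unique (hL.congr fun m =>
      setIntegral_arctan_mul_cpderiv hw hg hwk h1 h2 hη (hc m)) hR.neg
    simpa using heq.symm
  filter_upwards [hz] with x hx h0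
  simpa [h0] using hx

/-! ### Smooth functions with constant Laplacian are global minimizers -/

lemma memLp_two_of_continuous {Ω : Set (RH n)} (hΩ : IsOpen Ω) (hb : Bornology.IsBounded Ω)
    {f : RH n → ℝ} (hf : Continuous f) : MemLp f 2 (volume.restrict Ω) := by
  have : IsFiniteMeasure (volume.restrict Ω) :=
    ⟨by rw [Measure.restrict_apply_univ]; exact hb.measure_lt_top⟩
  obtain ⟨C, hC⟩ := hb.isCompact_closure.exists_bound_of_continuousOn hf.continuousOn
  refine MemLp.of_bound hf.aestronglyMeasurable C ?_
  filter_upwards [ae_restrict_mem hΩ.measurableSet] with x hx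
  exact hC x (subset_closure hx)

lemma ContDiff.memH2loc {f : RH n → ℝ} (hf : ContDiff ℝ (⊤ : ℕ∞) f) : MemH2loc f := by
  intro Ω hΩ hb
  refine ⟨fun i => _root_.cpderiv i f, fun i j => _root_.cpderiv j (_root_.cpderiv i f),
    memLp_two_of_continuous hΩ hb hf.continuous, fun i => ⟨fun η hη => ?_, ?_⟩,
    fun i j => ⟨fun η hη => ?_, ?_⟩⟩
  · exact setIntegral_mul_cpderiv (hf.of_le (by simp)) hη i
  · exact memLp_two_of_continuous hΩ hb (hf.cpderiv i).continuous
  · exact setIntegral_mul_cpderiv ((hf.cpderiv i).of_le (by simp)) hη j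
  · exact memLp_two_of_continuous hΩ hb ((hf.cpderiv i).cpderiv j).continuous

lemma cpderiv_add {f g : RH n → ℝ} (hf : ContDiff ℝ (⊤ : ℕ∞) f) (hg : ContDiff ℝ (⊤ : ℕ∞) g)
    (i : Fin n) : cpderiv i (fun x => f x + g x) = fun x => cpderiv i f x + cpderiv i g x := by
  ext x
  simp only [cpderiv]
  rw [fderiv_fun_add (hf.differentiable (by simp) x) (hg.differentiable (by simp) x)]
  rfl

lemma setIntegral_cpderiv_eq_zero {Ω : Set (RH n)} {η : RH n → ℝ} (hη : IsTestFun Ω η)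
    (i : Fin n) : ∫ x in Ω, cpderiv i η x = 0 := by
  have := setIntegral_mul_cpderiv (Ω := Ω) (f := fun _ => (1 : ℝ)) contDiff_const hη i
  simpa [show cpderiv i (fun _ : RH n => (1 : ℝ)) = 0 by ext x; simp [cpderiv]] using this

lemma IsTestFun.integrable_mul {Ω : Set (RH n)} {f η : RH n → ℝ}
    (hf : Integrable f (volume.restrict Ω)) (hη : IsTestFun Ω η) :
    Integrable (fun x => f x * η x) (volume.restrict Ω) := by
  obtain ⟨C, hC⟩ := hη.exists_abs_le
  exact hf.mul_bdd hη.continuous.aestronglyMeasurable (Eventually.of_forall hC)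

lemma ContDiff.isWeakLaplacian {u : RH n → ℝ} (hu : ContDiff ℝ (⊤ : ℕ∞) u) {Ω : Set (RH n)}
    (hΩ : IsOpen Ω) (hb : Bornology.IsBounded Ω) : IsWeakLaplacian Ω u (cLaplacian u) := by
  intro η hη
  have : IsFiniteMeasure (volume.restrict Ω) :=
    ⟨by rw [Measure.restrict_apply_univ]; exact hb.measure_lt_top⟩
  have hi : ∀ f : RH n → ℝ, Continuous f → Integrable f (volume.restrict Ω) := fun f hf =>
    (memLp_two_of_continuous hΩ hb hf).integrable (by norm_num)
  simp only [cLaplacian, Finset.mul_sum, Finset.sum_mul]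
  rw [integral_finsetSum, integral_finsetSum]
  · refine Finset.sum_congr rfl fun i _ => ?_
    rw [setIntegral_mul_cpderiv (hu.of_le (by simp)) (hη.cpderiv i) i,
      setIntegral_mul_cpderiv ((hu.cpderiv i).of_le (by simp)) hη i, neg_neg]
  · exact fun i _ => hη.integrable_mul (hi _ ((hu.cpderiv i).cpderiv i).continuous)
  · exact fun i _ => ((hη.cpderiv i).cpderiv i).integrable_mul (hi _ hu.continuous)

lemma IsH2With.isWeakLaplacian {Ω : Set (RH n)} [IsFiniteMeasure (volume.restrict Ω)]
    {w : RH n → ℝ} {g : Fin n → RH n → ℝ} {h : Fin n → Fin n → RH n → ℝ}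
    (hw : IsH2With Ω w g h) : IsWeakLaplacian Ω w (fun x => ∑ i, h i i x) := by
  intro η hη
  simp only [cLaplacian, Finset.mul_sum, Finset.sum_mul]
  rw [integral_finsetSum, integral_finsetSum]
  · refine Finset.sum_congr rfl fun i _ => ?_
    rw [(hw.2.1 i).1 _ (hη.cpderiv i), (hw.2.2 i i).1 _ hη, neg_neg]
  · exact fun i _ => hη.integrable_mul ((hw.2.2 i i).2.integrable (by norm_num))
  · exact fun i _ => ((hη.cpderiv i).cpderiv i).integrable_mul (hw.1.integrable (by norm_num))

lemma ACF_nonneg (Ω : Set (RH n)) (lapu u : RH n → ℝ) : 0 ≤ ACF Ω lapu u :=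
  add_nonneg (integral_nonneg fun _ => sq_nonneg _) ENNReal.toReal_nonneg

lemma IsTestFun.continuous_cLaplacian {Ω : Set (RH n)} {η : RH n → ℝ} (hη : IsTestFun Ω η) :
    Continuous (cLaplacian η) :=
  continuous_finsetSum _ fun i _ => ((hη.cpderiv i).cpderiv i).continuous

lemma IsTestFun.hasCompactSupport_cLaplacian {Ω : Set (RH n)} {η : RH n → ℝ}
    (hη : IsTestFun Ω η) : HasCompactSupport (cLaplacian η) := by
  refine HasCompactSupport.of_support_subset_isCompact hη.2.1 fun x hx => ?_
  by_contra hx'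
  refine hx (Finset.sum_eq_zero fun i _ => ?_)
  have : x ∉ tsupport (_root_.cpderiv i (_root_.cpderiv i η)) := fun hh => hx'
    ((tsupport_fderiv_apply_subset ℝ _).trans (tsupport_fderiv_apply_subset ℝ _) hh)
  exact image_eq_zero_of_notMem_tsupport this

lemma IsWeakLaplacian.of_sub {Ω : Set (RH n)} [IsFiniteMeasure (volume.restrict Ω)]
    {u v L D : RH n → ℝ} (huL2 : MemLp u 2 (volume.restrict Ω))
    (hvL2 : MemLp (fun x => v x - u x) 2 (volume.restrict Ω))
    (hLi : Integrable L (volume.restrict Ω)) (hDi : Integrable D (volume.restrict Ω))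
    (hu : IsWeakLaplacian Ω u L) (hw : IsWeakLaplacian Ω (fun x => v x - u x) D) :
    IsWeakLaplacian Ω v (fun x => L x + D x) := by
  intro η hη
  have h1 := hu η hη
  have h2 := hw η hη
  obtain ⟨C, hC⟩ := hη.hasCompactSupport_cLaplacian.exists_bound_of_continuous hη.continuous_cLaplacian
  have h_int : ∀ f : RH n → ℝ, MemLp f 2 (volume.restrict Ω) →
      Integrable (fun x => f x * cLaplacian η x) (volume.restrict Ω) := fun f hf =>
    (hf.integrable (by norm_num)).mul_bdd hη.continuous_cLaplacian.aestronglyMeasurable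
      (Eventually.of_forall hC)
  calc ∫ x in Ω, v x * cLaplacian η x
      = ∫ x in Ω, (u x * cLaplacian η x + (v x - u x) * cLaplacian η x) := by
        congr 1; ext x; ring
    _ = ∫ x in Ω, (L x * η x + D x * η x) := by
        rw [integral_add (h_int u huL2) (h_int _ hvL2), h1, h2, integral_add
          (hη.integrable_mul hLi) (hη.integrable_mul hDi)]
    _ = ∫ x in Ω, (L x + D x) * η x := by
        congr 1; ext x; ring

lemma integral_eq_zero_of_tendsto_cpderiv {Ω : Set (RH n)} (hΩ : IsOpen Ω)
    (hb : Bornology.IsBounded Ω) {f : RH n → ℝ} {i : Fin n} {φ : ℕ → RH n → ℝ}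
    (hf : MemLp f 2 (volume.restrict Ω)) (hφ : ∀ k, IsTestFun Ω (φ k))
    (hlim : Tendsto (fun k => eLpNorm (fun x => f x - cpderiv i (φ k) x) 2
      (volume.restrict Ω)) atTop (𝓝 0)) : ∫ x in Ω, f x = 0 := by
  have hfin : IsFiniteMeasure (volume.restrict Ω) :=
    ⟨by rw [Measure.restrict_apply_univ]; exact hb.measure_lt_top⟩
  have hc : ∀ k, Continuous (cpderiv i (φ k)) := fun k => ((hφ k).cpderiv i).continuous
  have h1 := tendsto_integral_mul_of_tendsto_eLpNorm (m := fun _ _ => 1) (M := 1)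
    (fun k => hf.1.sub (hc k).aestronglyMeasurable) (fun _ _ => by simp) hlim
  refine tendsto_nhds_unique (tendsto_const_nhds.congr fun k => ?_) h1
  simp only [one_mul, Pi.sub_apply]
  rw [integral_sub (hf.integrable (by norm_num))
    ((memLp_two_of_continuous hΩ hb (hc k)).integrable (by norm_num)),
    setIntegral_cpderiv_eq_zero (hφ k), sub_zero]

/-- If `v` is a smooth function plus an element of `H₀²`, then the Laplacian of `v` vanishes almost
everywhere on the zero set of `v`. -/
lemma ae_eq_zero_imp_laplacian_eq_zero {Ω : Set (RH n)} (hΩ : IsOpen Ω)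
    (hb : Bornology.IsBounded Ω) {u v : RH n → ℝ} {g : Fin n → RH n → ℝ}
    {h : Fin n → Fin n → RH n → ℝ} {φ : ℕ → RH n → ℝ} (hu : ContDiff ℝ (⊤ : ℕ∞) u)
    (hvL2 : MemLp v 2 (volume.restrict Ω)) (hgh : IsH2With Ω (fun x => v x - u x) g h)
    (hφ : ∀ k, IsTestFun Ω (φ k))
    (hφ0 : Tendsto (fun k => eLpNorm (fun x => v x - u x - φ k x) 2 (volume.restrict Ω))
      atTop (𝓝 0))
    (hφ1 : ∀ i, Tendsto (fun k => eLpNorm (fun x => g i x - cpderiv i (φ k) x) 2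
      (volume.restrict Ω)) atTop (𝓝 0))
    (hφ2 : ∀ i j, Tendsto (fun k => eLpNorm (fun x => h i j x - cpderiv j (cpderiv i (φ k)) x) 2
      (volume.restrict Ω)) atTop (𝓝 0)) :
    ∀ᵐ x ∂(volume.restrict Ω), v x = 0 → cLaplacian u x + ∑ i, h i i x = 0 := by
  have hfin : IsFiniteMeasure (volume.restrict Ω) :=
    ⟨by rw [Measure.restrict_apply_univ]; exact hb.measure_lt_top⟩
  have hLp : ∀ f : RH n → ℝ, Continuous f → MemLp f 2 (volume.restrict Ω) := fun f hf =>
    memLp_two_of_continuous hΩ hb hf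
  have h1 : ∀ i, ∀ᵐ x ∂(volume.restrict Ω), v x = 0 → cpderiv i u x + g i x = 0 := by
    intro i
    refine ae_eq_zero_imp_deriv_eq_zero (wk := fun k x => u x + φ k x) (i := i) hΩ hvL2
      ((hLp _ (hu.cpderiv i).continuous).add (hgh.2.1 i).2)
      (fun k => hu.add (hφ k).1) (hφ0.congr fun k => ?_) ((hφ1 i).congr fun k => ?_)
    · congr 1; ext x; ring
    · rw [cpderiv_add hu (hφ k).1]
      congr 1; ext x; simp
  have h2 : ∀ i, ∀ᵐ x ∂(volume.restrict Ω), cpderiv i u x + g i x = 0 →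
      cpderiv i (cpderiv i u) x + h i i x = 0 := by
    intro i
    refine ae_eq_zero_imp_deriv_eq_zero
      (wk := fun k x => cpderiv i u x + cpderiv i (φ k) x) (i := i) hΩ
      ((hLp _ (hu.cpderiv i).continuous).add (hgh.2.1 i).2)
      ((hLp _ ((hu.cpderiv i).cpderiv i).continuous).add (hgh.2.2 i i).2)
      (fun k => (hu.cpderiv i).add ((hφ k).cpderiv i).1)
      ((hφ1 i).congr fun k => ?_) ((hφ2 i i).congr fun k => ?_)
    · congr 1; ext x; ring
    · rw [cpderiv_add (hu.cpderiv i) ((hφ k).cpderiv i).1]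
      congr 1; ext x; simp
  filter_upwards [ae_all_iff.2 h1, ae_all_iff.2 h2] with x hx1 hx2 hx
  rw [cLaplacian, ← Finset.sum_add_distrib]
  exact Finset.sum_eq_zero fun i _ => hx2 i (hx1 i hx)

/-- The energy of `u` is `2 |Ω|`; any competitor `v` satisfies
`(Δv)² + 1_{v ≠ 0} ≥ 2 Δv` almost everywhere, because `Δv = 0` almost everywhere
on `{v = 0}`, and `∫ Δv = |Ω|`. -/
theorem isGlobalMinimizer_of_cLaplacian_eq_one {u : RH n → ℝ} (hu : ContDiff ℝ (⊤ : ℕ∞) u)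
    (hlap : cLaplacian u = fun _ => 1) : IsGlobalMinimizer u := by
  refine ⟨hu.memH2loc, fun Ω hΩ hb v hv hvu lapu lapv hlu hlv => ?_⟩
  have hfin : IsFiniteMeasure (volume.restrict Ω) :=
    ⟨by rw [Measure.restrict_apply_univ]; exact hb.measure_lt_top⟩
  have hvol : volume Ω ≠ ∞ := hb.measure_lt_top.ne
  obtain ⟨-, -, hvL2, -⟩ := hv
  obtain ⟨g, h, hgh, φ, hφ, hφ0, hφ1, hφ2⟩ := hvu
  have hLp : ∀ f : RH n → ℝ, Continuous f → MemLp f 2 (volume.restrict Ω) := fun f hf =>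
    memLp_two_of_continuous hΩ hb hf
  have hwu := hu.isWeakLaplacian hΩ hb
  rw [hlap] at hwu
  have hsL2 : MemLp (fun x => ∑ i, h i i x) 2 (volume.restrict Ω) :=
    memLp_finsetSum _ fun i _ => (hgh.2.2 i i).2
  have hDL2 : MemLp (fun x => 1 + ∑ i, h i i x) 2 (volume.restrict Ω) :=
    (hLp (fun _ => 1) continuous_const).add hsL2
  have hDi : Integrable (fun x => 1 + ∑ i, h i i x) (volume.restrict Ω) :=
    hDL2.integrable (by norm_num)
  have hsi : Integrable (fun x => ∑ i, h i i x) (volume.restrict Ω) :=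
    hsL2.integrable (by norm_num)
  have hwv : IsWeakLaplacian Ω v (fun x => 1 + ∑ i, h i i x) :=
    IsWeakLaplacian.of_sub (hLp u hu.continuous) hgh.1 (integrable_const _) hsi hwu
      hgh.isWeakLaplacian
  have hint0 : ∫ x in Ω, ∑ i, h i i x = 0 := by
    rw [integral_finsetSum _ fun i _ => (hgh.2.2 i i).2.integrable (by norm_num)]
    exact Finset.sum_eq_zero fun i _ => integral_eq_zero_of_tendsto_cpderiv hΩ hb
      (hgh.2.2 i i).2 (fun k => (hφ k).cpderiv i) (hφ2 i i)
  by_cases hΩ0 : volume Ω = 0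
  · have : ACF Ω lapu u = 0 := by
      simp [ACF, Measure.restrict_eq_zero.2 hΩ0, measure_mono_null (sep_subset Ω _) hΩ0]
    rw [this]
    exact ACF_nonneg _ _ _
  have hae_ne : (ae (volume.restrict Ω)).NeBot := by
    rw [ae_neBot]
    exact fun hh => hΩ0 (Measure.restrict_eq_zero.1 hh)
  have hlapu : ∀ᵐ x ∂(volume.restrict Ω), lapu x = 1 := by
    refine (ae_eq_or_ae_eq_zero_of_forall_testFun (L := fun _ => 1) hΩ (integrable_const _)
      fun η hη => (hlu η hη).symm.trans (hwu η hη)).resolve_right fun hh => ?_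
    obtain ⟨x, hx⟩ := hh.exists
    exact one_ne_zero hx
  have hlapv : ∀ᵐ x ∂(volume.restrict Ω), lapv x = 1 + ∑ i, h i i x := by
    refine (ae_eq_or_ae_eq_zero_of_forall_testFun hΩ hDi
      fun η hη => (hlv η hη).symm.trans (hwv η hη)).resolve_right fun hh => ?_
    have h1 := integral_congr_ae hh
    rw [integral_add (integrable_const _) hsi, hint0] at h1
    simp [Measure.real, ENNReal.toReal_eq_zero_iff, hΩ0, hvol] at h1
  have hvan : ∀ᵐ x ∂(volume.restrict Ω), v x = 0 → 1 + ∑ i, h i i x = 0 := by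
    have := ae_eq_zero_imp_laplacian_eq_zero hΩ hb hu hvL2 hgh hφ hφ0 hφ1 hφ2
    rwa [hlap] at this
  have hnull : NullMeasurableSet {x | v x ≠ 0} (volume.restrict Ω) :=
    (hvL2.1.nullMeasurableSet_eq_fun aestronglyMeasurable_zero).compl
  have hset : (volume {x ∈ Ω | v x ≠ 0}).toReal
      = ∫ x in Ω, {x | v x ≠ 0}.indicator (fun _ => (1 : ℝ)) x := by
    rw [integral_indicator₀ hnull, setIntegral_const, smul_eq_mul, mul_one, Measure.real,
      Measure.restrict_apply₀ hnull, inter_comm]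
    rfl
  have hupper : ACF Ω lapu u ≤ 2 * (volume Ω).toReal := by
    have h1 : ∫ x in Ω, (lapu x) ^ 2 = (volume Ω).toReal := by
      rw [integral_congr_ae (g := fun _ => (1 : ℝ)) (hlapu.mono fun x hx => by simp [hx])]
      simp [Measure.real]
    have h2 := ENNReal.toReal_mono hvol (measure_mono (μ := volume) (sep_subset Ω (fun x => u x ≠ 0)))
    rw [ACF, h1]
    linarith
  refine hupper.trans ?_
  have hsq : Integrable (fun x => (lapv x) ^ 2) (volume.restrict Ω) :=
    hDL2.integrable_sq.congr (hlapv.mono fun x hx => by simp [hx])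
  have hind : Integrable ({x | v x ≠ 0}.indicator (fun _ => (1 : ℝ))) (volume.restrict Ω) :=
    (integrable_const _).indicator₀ hnull
  rw [ACF, hset, ← integral_add hsq hind]
  have h2 : ∫ x in Ω, 2 * (1 + ∑ i, h i i x) = 2 * (volume Ω).toReal := by
    rw [integral_const_mul, integral_add (integrable_const _) hsi, hint0]
    simp [Measure.real]
  rw [← h2]
  refine integral_mono_ae (hDi.const_mul 2) (hsq.add hind) ?_
  filter_upwards [hlapv, hvan] with x hx1 hx2
  by_cases hx : v x = 0
  · simp [hx1, hx2 hx, hx]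
  · simp only [hx1, ne_eq, mem_ofPred_eq, hx, not_false_eq_true, indicator_of_mem]
    nlinarith [sq_nonneg (∑ i, h i i x)]
/-! ### The paraboloid in the plane -/

lemma contDiff_normSq_div_four : ContDiff ℝ (⊤ : ℕ∞) (fun x : RH n => ‖x‖ ^ 2 / 4) :=
  (contDiff_norm_sq ℝ).div_const _

lemma hasFDerivAt_normSq_div_four (x : RH n) :
    HasFDerivAt (fun x : RH n => ‖x‖ ^ 2 / 4) ((1 / 2 : ℝ) • innerSL ℝ x) x := by
  have h1 := (hasStrictFDerivAt_norm_sq x).hasFDerivAt.mul_const (4 : ℝ)⁻¹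
  simp only [div_eq_mul_inv]
  have h2 : (4 : ℝ)⁻¹ • (2 • innerSL ℝ x) = (1 / 2 : ℝ) • innerSL ℝ x := by
    ext y
    simp
    ring
  rw [h2] at h1
  exact h1

lemma cpderiv_normSq_div_four (i : Fin n) :
    cpderiv i (fun x : RH n => ‖x‖ ^ 2 / 4) = fun x => (1 / 2 : ℝ) * x i := by
  ext x
  rw [cpderiv, (hasFDerivAt_normSq_div_four x).fderiv]
  simp [EuclideanSpace.inner_single_right]

lemma cpderiv_coord (i : Fin n) (c : ℝ) :
    cpderiv i (fun x : RH n => c * x i) = fun _ => c := by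
  ext x
  have h1 : HasFDerivAt (fun x : RH n => c * x i)
      (c • (EuclideanSpace.proj i : RH n →L[ℝ] ℝ)) x :=
    (c • (EuclideanSpace.proj i : RH n →L[ℝ] ℝ)).hasFDerivAt
  rw [cpderiv, h1.fderiv]
  simp

lemma cLaplacian_normSq_div_four :
    cLaplacian (fun x : RH 2 => ‖x‖ ^ 2 / 4) = fun _ => 1 := by
  ext x
  simp [cLaplacian, cpderiv_normSq_div_four, cpderiv_coord]

lemma freeBoundary_normSq_div_four :
    FreeBoundary (fun x : RH 2 => ‖x‖ ^ 2 / 4) = {0} := by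
  have : {x : RH 2 | ‖x‖ ^ 2 / 4 = 0 ∧ fderiv ℝ (fun x : RH 2 => ‖x‖ ^ 2 / 4) x = 0} = {0} := by
    ext x
    constructor
    · rintro ⟨h, -⟩
      simpa using h
    · rintro rfl
      refine ⟨by simp, ?_⟩
      rw [(hasFDerivAt_normSq_div_four 0).fderiv]
      simp
  rw [FreeBoundary, this, frontier, closure_singleton, interior_singleton, sdiff_empty]

/-- A single point of the plane is not a curve: a real function with an isolated zero
has constant sign on small circles around it, so it is not a submersion there. -/
lemma not_isC1Submanifold_singleton : ¬ IsC1Submanifold 2 1 {(0 : RH 2)} := by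
  intro H
  obtain ⟨U, hU, h0, f, hf, hfU, hsurj⟩ := H 0 rfl
  have hz : ∀ y ∈ U, y ≠ 0 → f y ≠ 0 := by
    intro y hy hy0 hfy
    have : y ∈ ({0} : Set (RH 2)) ∩ U := by
      rw [hfU]
      exact ⟨hy, hfy⟩
    exact hy0 this.1
  have hs := hsurj 0 ⟨rfl, h0⟩
  have hf0 : f 0 = 0 := by
    have : (0 : RH 2) ∈ ({0} : Set (RH 2)) ∩ U := ⟨rfl, h0⟩
    rw [hfU] at this
    exact this.2
  rw [fderivWithin_of_isOpen hU h0] at hs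
  have hd : HasFDerivAt f (fderiv ℝ f 0) 0 :=
    ((hf.contDiffAt (hU.mem_nhds h0)).differentiableAt (by simp)).hasFDerivAt
  obtain ⟨e, he⟩ := hs (EuclideanSpace.single (0 : Fin 1) 1)
  set p : RH 2 → ℝ := fun y => f y (0 : Fin 1) with hp
  have hp0 : ∀ y, p y = 0 → f y = 0 := by
    intro y hy
    ext j
    fin_cases j
    exact hy
  have hpd : HasDerivAt (fun t : ℝ => p (t • e)) 1 0 := by
    have h1 : HasDerivAt (fun t : ℝ => t • e) e 0 := by
      simpa using (hasDerivAt_id (0 : ℝ)).smul_const e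
    have h2 : HasFDerivAt p ((EuclideanSpace.proj (0 : Fin 1) :
        EuclideanSpace ℝ (Fin 1) →L[ℝ] ℝ).comp (fderiv ℝ f 0)) ((0 : ℝ) • e) := by
      rw [zero_smul]
      exact (EuclideanSpace.proj (0 : Fin 1) :
        EuclideanSpace ℝ (Fin 1) →L[ℝ] ℝ).hasFDerivAt.comp (0 : RH 2) hd
    have h3 := h2.comp_hasDerivAt (0 : ℝ) h1
    have h4 : ((EuclideanSpace.proj (0 : Fin 1) : EuclideanSpace ℝ (Fin 1) →L[ℝ] ℝ).comp
        (fderiv ℝ f 0)) e = 1 := by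
      rw [ContinuousLinearMap.comp_apply, he]
      simp
    rw [h4] at h3
    exact h3
  have hpz : p ((0 : ℝ) • e) = 0 := by simp [hp, hf0]
  obtain ⟨r, hr, hrU⟩ := Metric.isOpen_iff.1 hU 0 h0
  have hslope : ∀ᶠ t in 𝓝[≠] (0 : ℝ), 0 < t⁻¹ * p (t • e) := by
    have := hpd.tendsto_slope_zero
    simp only [zero_add, hpz, sub_zero, smul_eq_mul] at this
    exact this.eventually (lt_mem_nhds one_pos)
  rw [eventually_nhdsWithin_iff, Metric.eventually_nhds_iff] at hslope
  obtain ⟨δ, hδ, hslope⟩ := hslope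
  have hen : 0 < ‖e‖ := by
    rw [norm_pos_iff]
    rintro rfl
    rw [map_zero] at he
    simpa using congrArg (fun v : EuclideanSpace ℝ (Fin 1) => v 0) he
  obtain ⟨t, ht0, ht⟩ := exists_between (lt_min hδ (div_pos hr hen))
  have ht1 : t < δ := ht.trans_le (min_le_left _ _)
  have ht2 : t * ‖e‖ < r := (lt_div_iff₀ hen).1 (ht.trans_le (min_le_right _ _))
  have hpos : 0 < p (t • e) := by
    have := hslope (y := t) (by simpa [abs_of_pos ht0] using ht1) ht0.ne'
    exact (pos_iff_pos_of_mul_pos this).1 (inv_pos.2 ht0)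
  have hneg : p ((-t) • e) < 0 := by
    have := hslope (y := -t) (by simpa [abs_of_pos ht0] using ht1) (neg_ne_zero.2 ht0.ne')
    exact (neg_iff_neg_of_mul_pos this).1 (inv_lt_zero.2 (neg_lt_zero.2 ht0))
  have hconn : IsPreconnected (sphere (0 : RH 2) (t * ‖e‖)) := by
    refine (isConnected_sphere ?_ 0 (by positivity)).isPreconnected
    rw [← Module.finrank_eq_rank]
    simp
  have hsU : sphere (0 : RH 2) (t * ‖e‖) ⊆ U := fun y hy =>
    hrU (by rw [mem_sphere] at hy; rw [mem_ball, hy]; exact ht2)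
  have hcont : ContinuousOn p (sphere (0 : RH 2) (t * ‖e‖)) :=
    (EuclideanSpace.proj (0 : Fin 1) : EuclideanSpace ℝ (Fin 1) →L[ℝ] ℝ).continuous.comp_continuousOn
      (hf.continuousOn.mono hsU)
  obtain ⟨y, hy, hy0⟩ := hconn.intermediate_value (a := (-t) • e) (b := t • e)
    (by simp [norm_smul, abs_of_pos ht0]) (by simp [norm_smul, abs_of_pos ht0]) hcont
    ⟨hneg.le, hpos.le⟩
  refine hz y (hsU hy) ?_ (hp0 y hy0)
  rintro rfl
  rw [mem_sphere, dist_self] at hy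
  exact (mul_pos ht0 hen).ne hy

/-! ### Dimensions zero and one -/

lemma TwoHomogeneous.map_zero {z : RH n → ℝ} (hz : TwoHomogeneous z) : z 0 = 0 := by
  have := hz 2 two_pos 0
  rw [smul_zero] at this
  linarith

lemma not_hasSingular_zero : ¬ HasSingularTwoHomogeneousMinimizer 0 := by
  rintro ⟨z, hz, hz2, -⟩
  refine hz (funext fun x => ?_)
  rw [Subsingleton.elim x 0, hz2.map_zero]

lemma TwoHomogeneous.eq_zero_iff_of_mul_pos {z : RH 1 → ℝ} (hz : TwoHomogeneous z) {x y : RH 1}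
    (hxy : 0 < x 0 * y 0) : z y = 0 ↔ z x = 0 := by
  have hx : x 0 ≠ 0 := left_ne_zero_of_mul hxy.ne'
  have hpos : 0 < y 0 / x 0 := by
    rw [show y 0 / x 0 = x 0 * y 0 / (x 0) ^ 2 by field_simp]
    positivity
  have hy : y = (y 0 / x 0) • x := by
    ext j
    fin_cases j
    simp [hx]
  rw [hy, hz _ hpos]
  simp [hpos.ne']

lemma TwoHomogeneous.freeBoundary_subset {z : RH 1 → ℝ} (hz : TwoHomogeneous z) :
    FreeBoundary z ⊆ {0} := by
  intro x hx
  by_contra hx0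
  have hx0 : x 0 ≠ 0 := fun h => hx0 (by ext j; fin_cases j; exact h)
  have hopen : IsOpen {y : RH 1 | 0 < x 0 * y 0} := isOpen_lt continuous_const (by fun_prop)
  have hmem : x ∈ {y : RH 1 | 0 < x 0 * y 0} := mul_self_pos.2 hx0
  by_cases hzx : z x = 0
  · refine hx.2 (mem_interior.2 ⟨_, fun y hy => ?_, hopen, hmem⟩)
    refine ⟨(hz.eq_zero_iff_of_mul_pos hy).2 hzx, ?_⟩
    have : z =ᶠ[𝓝 y] fun _ => 0 := by
      filter_upwards [hopen.mem_nhds hy] with w hw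
      exact (hz.eq_zero_iff_of_mul_pos hw).2 hzx
    rw [this.fderiv_eq]
    simp
  · obtain ⟨y, hy, hzy, -⟩ := mem_closure_iff.1 hx.1 _ hopen hmem
    exact hzx ((hz.eq_zero_iff_of_mul_pos hy).1 hzy)

lemma not_hasSingular_one : ¬ HasSingularTwoHomogeneousMinimizer 1 := by
  rintro ⟨z, -, hz2, -, hs⟩
  refine hs fun x hx => ?_
  have hsub := hz2.freeBoundary_subset
  obtain rfl : x = 0 := hsub hx
  refine ⟨univ, isOpen_univ, mem_univ _, id, contDiff_id.contDiffOn, ?_, fun y _ => ?_⟩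
  · rw [Subset.antisymm hsub (singleton_subset_iff.2 hx)]
    ext y
    simp
  · rw [fderivWithin_univ, fderiv_id]
    exact Function.surjective_id

/-- the critical dimension `d**` of the biharmonic Alt–Caffarelli
problem equals `2`; in particular `w(x) = |x|²/4` on `ℝ²` is a nontrivial
two-homogeneous global minimizer whose free boundary `{0}` is not a
`1`-dimensional `C¹`-submanifold of `ℝ²`. -/
theorem statement11 :
    sInf {d : ℕ | HasSingularTwoHomogeneousMinimizer d} = 2 ∧
    (fun x : RH 2 => ‖x‖ ^ 2 / 4) ≠ (fun _ => 0) ∧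
    TwoHomogeneous (fun x : RH 2 => ‖x‖ ^ 2 / 4) ∧
    IsGlobalMinimizer (fun x : RH 2 => ‖x‖ ^ 2 / 4) ∧
    FreeBoundary (fun x : RH 2 => ‖x‖ ^ 2 / 4) = {0} ∧
    ¬ IsC1Submanifold 2 1 (FreeBoundary (fun x : RH 2 => ‖x‖ ^ 2 / 4)) := by
  have hne : (fun x : RH 2 => ‖x‖ ^ 2 / 4) ≠ (fun _ => 0) := fun h => by
    simpa using congrFun h (EuclideanSpace.single 0 1)
  have hhom : TwoHomogeneous (fun x : RH 2 => ‖x‖ ^ 2 / 4) := by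
    intro lam hlam x
    simp only [norm_smul, Real.norm_eq_abs, abs_of_pos hlam]
    ring
  have hmin : IsGlobalMinimizer (fun x : RH 2 => ‖x‖ ^ 2 / 4) :=
    isGlobalMinimizer_of_cLaplacian_eq_one contDiff_normSq_div_four cLaplacian_normSq_div_four
  have hsub : ¬ IsC1Submanifold 2 1 (FreeBoundary (fun x : RH 2 => ‖x‖ ^ 2 / 4)) := by
    rw [freeBoundary_normSq_div_four]
    exact not_isC1Submanifold_singleton
  refine ⟨?_, hne, hhom, hmin, freeBoundary_normSq_div_four, hsub⟩
  have h2 : HasSingularTwoHomogeneousMinimizer 2 := ⟨_, hne, hhom, hmin, hsub⟩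
  refine le_antisymm (Nat.sInf_le h2) (le_csInf ⟨2, h2⟩ fun d hd => ?_)
  by_contra! hlt
  interval_cases d
  · exact not_hasSingular_zero hd
  · exact not_hasSingular_one hd

end
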